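/- For any binary operation * on I and any t-norm Δ on I, there exist f, g ∈ L such that f✶g ≠ f⋏g, where (f⋏g)(x) = sup{f(y)*g(z) : y Δ z = x}. That is, the operation ✶ cannot be obtained by the convolution formula ⋏. -/

import Mathlib

noncomputable section

attribute [local instance] Classical.propDecidable

instance : Fact ((0:ℝ) ≤ 1) := ⟨zero_le_one⟩

/-- The unit interval `I = [0,1]`. -/
abbrev I01 := unitInterval

/-- `f^L (x) = sup {f y | y ≤ x}`. -/
def funL (f : I01 → I01) (x : I01) : I01 := sSup (f '' {y | y ≤ x})

/-- `f^R (x) = sup {f y | y ≥ x}`. -/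
def funR (f : I01 → I01) (x : I01) : I01 := sSup (f '' {y | x ≤ y})

/-- `f^{Lw}`. -/
def funLw (f : I01 → I01) (x : I01) : I01 :=
  if x = 0 then f 0 else sSup (f '' {y | y < x})

/-- A function is normal if `sup {f x | x ∈ I} = 1`. -/
def NormalFn (f : I01 → I01) : Prop := sSup (Set.range f) = 1

/-- A function is convex in the fuzzy sense. -/
def ConvexFn (f : I01 → I01) : Prop :=
  ∀ x y z : I01, x ≤ y → y ≤ z → min (f x) (f z) ≤ f y

/-- `L`, the set of all normal and convex functions from `I` to `I`. -/
def NC : Set (I01 → I01) := {f | NormalFn f ∧ ConvexFn f}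

/-- Characteristic function of a subset of `I`. -/
def ind (B : Set I01) : I01 → I01 := fun x => if x ∈ B then 1 else 0

/-- `(f ⊓ g)(x) = sup {min (f y) (g z) | min y z = x}`. -/
def meet (f g : I01 → I01) : I01 → I01 := fun x =>
  sSup {v | ∃ y z : I01, min y z = x ∧ v = min (f y) (g z)}

/-- The partial order `f ⊑ g` iff `f ⊓ g = f`. -/
def sqle (f g : I01 → I01) : Prop := meet f g = f

/-- `η_{f,g}`. -/
def etaLG (f g : I01 → I01) : I01 :=
  min (sInf {x | funL f x = 1}) (sInf {x | funL g x = 1})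

/-- `ξ_{f,g}`. -/
def xiLG (f g : I01 → I01) : I01 :=
  min (sSup {x | funR f x = 1}) (sSup {x | funR g x = 1})

/-- The operation `✶`. -/
def starOp (f g : I01 → I01) : I01 → I01 :=
  if f = ind {1} then g
  else if g = ind {1} then f
  else fun t =>
    if t < etaLG f g then max (funL f t) (funL g t)
    else if t < xiLG f g then 1
    else if t = xiLG f g then min (funR f (xiLG f g)) (funR g (xiLG f g))
    else 0

/-- A t-norm on `I`. -/
structure IsTnormI (op : I01 → I01 → I01) : Prop where
  comm : ∀ x y : I01, op x y = op y x
  assoc : ∀ x y z : I01, op (op x y) z = op x (op y z)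
  mono : ∀ x y z : I01, x ≤ y → op x z ≤ op y z ∧ op z x ≤ op z y
  one_op : ∀ x : I01, op 1 x = x
  op_one : ∀ x : I01, op x 1 = x

/-- A t-conorm on `I`. -/
structure IsTconormI (op : I01 → I01 → I01) : Prop where
  comm : ∀ x y : I01, op x y = op y x
  assoc : ∀ x y z : I01, op (op x y) z = op x (op y z)
  mono : ∀ x y z : I01, x ≤ y → op x z ≤ op y z ∧ op z x ≤ op z y
  zero_op : ∀ x : I01, op 0 x = x
  op_zero : ∀ x : I01, op x 0 = x

/-- The convolution operation `(f ⋏ g)(x) = sup {st (f y) (g z) | tri y z = x}`. -/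
def conv (st tri : I01 → I01 → I01) (f g : I01 → I01) : I01 → I01 := fun x =>
  sSup {v | ∃ y z : I01, tri y z = x ∧ v = st (f y) (g z)}

/-- Complementation `(¬ f)(x) = f (1 - x)`. -/
def negf (f : I01 → I01) : I01 → I01 := fun x => f (unitInterval.symm x)

/-- The dual operation `f ◇^∁ g = ¬((¬f) ◇ (¬g))`. -/
def dualOp (op : (I01 → I01) → (I01 → I01) → (I01 → I01)) :
    (I01 → I01) → (I01 → I01) → (I01 → I01) :=
  fun f g => negf (op (negf f) (negf g))

/-- A t-norm on `L` according to the basic axioms (O1)--(O4). -/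
def IsTnormOnL (T : (I01 → I01) → (I01 → I01) → (I01 → I01)) : Prop :=
  (∀ f ∈ NC, ∀ g ∈ NC, T f g = T g f) ∧
  (∀ f ∈ NC, ∀ g ∈ NC, ∀ h ∈ NC, T (T f g) h = T f (T g h)) ∧
  (∀ f ∈ NC, T f (ind {1}) = f) ∧
  (∀ f ∈ NC, ∀ g ∈ NC, ∀ h ∈ NC, sqle f g → sqle (T f h) (T g h))

/-- A t-conorm on `L` according to the basic axioms (O1), (O2), (O3'), (O4). -/
def IsTconormOnL (S : (I01 → I01) → (I01 → I01) → (I01 → I01)) : Prop :=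
  (∀ f ∈ NC, ∀ g ∈ NC, S f g = S g f) ∧
  (∀ f ∈ NC, ∀ g ∈ NC, ∀ h ∈ NC, S (S f g) h = S f (S g h)) ∧
  (∀ f ∈ NC, S f (ind {0}) = f) ∧
  (∀ f ∈ NC, ∀ g ∈ NC, ∀ h ∈ NC, sqle f g → sqle (S f h) (S g h))

/-- A `t_r`-norm on `L`: an operation on `L` satisfying axioms (O1)--(O7). -/
def IsTrNorm (T : (I01 → I01) → (I01 → I01) → (I01 → I01)) : Prop :=
  (∀ f ∈ NC, ∀ g ∈ NC, T f g ∈ NC) ∧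
  (∀ f ∈ NC, ∀ g ∈ NC, T f g = T g f) ∧
  (∀ f ∈ NC, ∀ g ∈ NC, ∀ h ∈ NC, T (T f g) h = T f (T g h)) ∧
  (∀ f ∈ NC, T f (ind {1}) = f) ∧
  (∀ f ∈ NC, ∀ g ∈ NC, ∀ h ∈ NC, sqle f g → sqle (T f h) (T g h)) ∧
  (∀ a b : I01, a ≤ b → T (ind (Set.Icc 0 1)) (ind (Set.Icc a b)) = ind (Set.Icc 0 b)) ∧
  (∀ x₁ x₂ : I01, ∃ x₃ : I01, T (ind {x₁}) (ind {x₂}) = ind {x₃}) ∧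
  (∀ a₁ b₁ a₂ b₂ : I01, a₁ ≤ b₁ → a₂ ≤ b₂ →
    ∃ a₃ b₃ : I01, a₃ ≤ b₃ ∧
      T (ind (Set.Icc a₁ b₁)) (ind (Set.Icc a₂ b₂)) = ind (Set.Icc a₃ b₃))

/-- A `t_r`-conorm on `L`: an operation on `L` satisfying axioms
(O1), (O2), (O3'), (O4), (O5'), (O6), (O7). -/
def IsTrConorm (S : (I01 → I01) → (I01 → I01) → (I01 → I01)) : Prop :=
  (∀ f ∈ NC, ∀ g ∈ NC, S f g ∈ NC) ∧
  (∀ f ∈ NC, ∀ g ∈ NC, S f g = S g f) ∧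
  (∀ f ∈ NC, ∀ g ∈ NC, ∀ h ∈ NC, S (S f g) h = S f (S g h)) ∧
  (∀ f ∈ NC, S f (ind {0}) = f) ∧
  (∀ f ∈ NC, ∀ g ∈ NC, ∀ h ∈ NC, sqle f g → sqle (S f h) (S g h)) ∧
  (∀ a b : I01, a ≤ b → S (ind (Set.Icc 0 1)) (ind (Set.Icc a b)) = ind (Set.Icc a 1)) ∧
  (∀ x₁ x₂ : I01, ∃ x₃ : I01, S (ind {x₁}) (ind {x₂}) = ind {x₃}) ∧
  (∀ a₁ b₁ a₂ b₂ : I01, a₁ ≤ b₁ → a₂ ≤ b₂ →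
    ∃ a₃ b₃ : I01, a₃ ≤ b₃ ∧
      S (ind (Set.Icc a₁ b₁)) (ind (Set.Icc a₂ b₂)) = ind (Set.Icc a₃ b₃))

/-- The divisors of `1` under a t-norm are trivial. -/
lemma IsTnormI.eq_one_of_op_eq_one {tri : I01 → I01 → I01} (htri : IsTnormI tri) {y z : I01}
    (h : tri y z = 1) : y = 1 ∧ z = 1 := by
  have hy : tri y z ≤ tri y 1 := (htri.mono z 1 y le_top).2
  have hz : tri y z ≤ tri 1 z := (htri.mono y 1 z le_top).1
  rw [h, htri.op_one] at hy
  rw [h, htri.one_op] at hz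
  exact ⟨le_antisymm le_top hy, le_antisymm le_top hz⟩

/-- At `1` the convolution only sees the values of its arguments at `1`. -/
lemma conv_apply_one (st : I01 → I01 → I01) {tri : I01 → I01 → I01} (htri : IsTnormI tri)
    (f g : I01 → I01) : conv st tri f g 1 = st (f 1) (g 1) := by
  have : {v | ∃ y z : I01, tri y z = 1 ∧ v = st (f y) (g z)} = {st (f 1) (g 1)} := by
    ext v
    constructor
    · rintro ⟨y, z, h, rfl⟩
      obtain ⟨rfl, rfl⟩ := htri.eq_one_of_op_eq_one h
      rfl
    · rintro rfl
      exact ⟨1, 1, htri.one_op 1, rfl⟩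
  rw [conv, this, sSup_singleton]

lemma funR_one (f : I01 → I01) : funR f 1 = f 1 := by
  have : {y : I01 | 1 ≤ y} = {1} := by
    ext y
    exact ⟨fun h => le_antisymm le_top h, fun h => h.ge⟩
  rw [funR, this, Set.image_singleton, sSup_singleton]

lemma le_funR (f : I01 → I01) {x y : I01} (h : x ≤ y) : f y ≤ funR f x :=
  le_sSup ⟨y, h, rfl⟩

lemma funR_le {f : I01 → I01} {x c : I01} (h : ∀ y, x ≤ y → f y ≤ c) : funR f x ≤ c := by
  apply sSup_le
  rintro _ ⟨y, hy, rfl⟩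
  exact h y hy

lemma normalFn_of_apply_zero {f : I01 → I01} (h : f 0 = 1) : NormalFn f :=
  le_antisymm le_top (le_sSup ⟨0, h⟩)

lemma mem_NC_of_antitone {f : I01 → I01} (hf : Antitone f) (h : f 0 = 1) : f ∈ NC :=
  ⟨normalFn_of_apply_zero h, fun _ _ _ _ hyz => (min_le_right _ _).trans (hf hyz)⟩

lemma ne_ind_one_of_apply_zero {f : I01 → I01} (h : f 0 = 1) : f ≠ ind {1} := by
  rintro rfl
  simp [ind] at h

lemma etaLG_eq_zero {f : I01 → I01} (g : I01 → I01) (h : f 0 = 1) : etaLG f g = 0 := by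
  have h0 : funL f 0 = 1 := le_antisymm le_top (le_sSup ⟨0, le_refl (0 : I01), h⟩)
  exact le_antisymm ((min_le_left _ _).trans (sInf_le h0)) bot_le

/-- The value of `f ✶ 1` at `1` for `f 0 = 1`. -/
lemma starOp_const_one_apply_one {f : I01 → I01} (h : f 0 = 1) :
    starOp f (fun _ => 1) 1 = if sSup {x | funR f x = 1} = 1 then f 1 else 0 := by
  have hR (x : I01) : funR (fun _ => 1) x = 1 :=
    le_antisymm le_top (le_funR (fun _ => 1) le_rfl)
  have hxi : xiLG f (fun _ => 1) = sSup {x | funR f x = 1} := by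
    have : {x : I01 | funR (fun _ => 1) x = 1} = Set.univ := Set.eq_univ_of_forall hR
    rw [xiLG, this, sSup_univ]
    exact min_eq_left le_top
  rw [starOp, if_neg (ne_ind_one_of_apply_zero h), if_neg (ne_ind_one_of_apply_zero rfl)]
  simp only [etaLG_eq_zero _ h, hxi]
  have h10 : ¬(1 : I01) < 0 := not_lt.2 zero_le_one
  have h1top (x : I01) : ¬1 < x := not_lt.2 le_top
  rw [if_neg h10, if_neg (h1top _)]
  by_cases h1 : sSup {x | funR f x = 1} = 1
  · rw [h1, if_pos rfl, if_pos rfl, hR, funR_one]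
    exact min_eq_left le_top
  · rw [if_neg (Ne.symm h1), if_neg h1]

/-- `✶` cannot be obtained by the convolution formula `⋏`. -/
theorem stmt1 (st tri : I01 → I01 → I01) (htri : IsTnormI tri) :
    ∃ f ∈ NC, ∃ g ∈ NC, starOp f g ≠ conv st tri f g := by
  by_contra! H
  obtain ⟨c, hc0, hc1⟩ := exists_between (zero_lt_one : (0 : I01) < 1)
  have key (f : I01 → I01) (hf : Antitone f) (h0 : f 0 = 1) (h1 : f 1 = c) :
      st c 1 = if sSup {x | funR f x = 1} = 1 then c else 0 := by
    rw [← h1, ← starOp_const_one_apply_one h0,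
      H f (mem_NC_of_antitone hf h0) _ (mem_NC_of_antitone antitone_const rfl),
      conv_apply_one st htri]
  have hlower : st c 1 = c := by
    let f : I01 → I01 := fun x => if x < 1 then 1 else c
    have hf : Antitone f := by
      intro x y hxy
      by_cases hx : x < 1
      · simp only [f, if_pos hx]
        exact le_top
      · have hy : ¬y < 1 := fun hy => hx (hxy.trans_lt hy)
        simp [f, hx, hy]
    rw [key f hf (by simp [f]) (by simp [f]), if_pos]
    refine le_antisymm le_top (le_of_forall_lt fun x hx => ?_)
    obtain ⟨y, hxy, hy⟩ := exists_between hx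
    have hy1 : f y = 1 := if_pos hy
    exact hxy.trans_le (le_sSup (le_antisymm le_top (hy1 ▸ le_funR f le_rfl)))
  have hupper : st c 1 = 0 := by
    let f : I01 → I01 := fun x => if x = 0 then 1 else c
    have hf : Antitone f := by
      intro x y hxy
      by_cases hx : x = 0
      · simp only [f, if_pos hx]
        exact le_top
      · have hy : y ≠ 0 := fun hy => hx (le_antisymm (hxy.trans hy.le) bot_le)
        simp [f, hx, hy]
    rw [key f hf (by simp [f]) (by simp [f]), if_neg]
    refine ne_of_lt (lt_of_le_of_lt (sSup_le fun x hx => ?_) zero_lt_one)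
    by_contra! hx0
    refine (hx.ge.trans (funR_le fun y hxy => ?_)).not_gt hc1
    exact (if_neg (hx0.trans_le hxy).ne').le
  exact hc0.ne' (hlower.symm.trans hupper)
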